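/- Let C be a possibly non-unital small C*-category with an action of a group G. Then the canonical homomorphism ν_C : A(C)⋊G → A(C⋊G) of C*-algebras, determined on generators by ([f],g) ↦ [(f,g)] for morphisms f of C and g ∈ G, is an isomorphism; that is, the functor A commutes with the formation of maximal crossed products. -/

import Mathlib

noncomputable section

open scoped ENNReal

/-- A possibly non-unital ℂ-linear ∗-category. -/
structure StarCatNu : Type 1 where
  Obj : Type
  Hom : Obj → Obj → Type
  [homAddCommGroup : ∀ X Y, AddCommGroup (Hom X Y)]
  [homModule : ∀ X Y, Module ℂ (Hom X Y)]
  comp : ∀ {X Y Z : Obj}, Hom Y Z → Hom X Y → Hom X Z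
  star : ∀ {X Y : Obj}, Hom X Y → Hom Y X
  comp_assoc : ∀ {W X Y Z : Obj} (h : Hom Y Z) (g : Hom X Y) (f : Hom W X),
    comp (comp h g) f = comp h (comp g f)
  add_comp : ∀ {X Y Z : Obj} (g g' : Hom Y Z) (f : Hom X Y),
    comp (g + g') f = comp g f + comp g' f
  comp_add : ∀ {X Y Z : Obj} (g : Hom Y Z) (f f' : Hom X Y),
    comp g (f + f') = comp g f + comp g f'
  smul_comp : ∀ {X Y Z : Obj} (c : ℂ) (g : Hom Y Z) (f : Hom X Y),
    comp (c • g) f = c • comp g f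
  comp_smul : ∀ {X Y Z : Obj} (c : ℂ) (g : Hom Y Z) (f : Hom X Y),
    comp g (c • f) = c • comp g f
  star_star : ∀ {X Y : Obj} (f : Hom X Y), star (star f) = f
  star_comp : ∀ {X Y Z : Obj} (g : Hom Y Z) (f : Hom X Y),
    star (comp g f) = comp (star f) (star g)
  star_add : ∀ {X Y : Obj} (f f' : Hom X Y), star (f + f') = star f + star f'
  star_smul : ∀ {X Y : Obj} (c : ℂ) (f : Hom X Y),
    star (c • f) = (starRingEnd ℂ) c • star f

attribute [instance] StarCatNu.homAddCommGroup StarCatNu.homModule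

namespace StarCatNu

/-- Transport of morphisms along equalities of objects. -/
def castHom (C : StarCatNu) {X X' Y Y' : C.Obj} (hX : X = X') (hY : Y = Y')
    (f : C.Hom X Y) : C.Hom X' Y' := hX ▸ hY ▸ f

theorem comp_zero (C : StarCatNu) {X Y Z : C.Obj} (g : C.Hom Y Z) :
    C.comp g (0 : C.Hom X Y) = 0 :=
  (AddMonoidHom.mk' (fun f : C.Hom X Y => C.comp g f) (C.comp_add g)).map_zero

theorem zero_comp (C : StarCatNu) {X Y Z : C.Obj} (f : C.Hom X Y) :
    C.comp (0 : C.Hom Y Z) f = 0 :=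
  (AddMonoidHom.mk' (fun g : C.Hom Y Z => C.comp g f) (fun a b => C.add_comp a b f)).map_zero

theorem star_zero' (C : StarCatNu) {X Y : C.Obj} :
    C.star (0 : C.Hom X Y) = 0 :=
  (AddMonoidHom.mk' (fun f : C.Hom X Y => C.star f) C.star_add).map_zero

end StarCatNu

/-- A (not necessarily unit-preserving) functor between possibly non-unital ℂ-linear
∗-categories, compatible with the enrichment and the involutions. -/
structure StarFunctor (C D : StarCatNu) where
  obj : C.Obj → D.Obj
  map : ∀ {X Y : C.Obj}, C.Hom X Y → D.Hom (obj X) (obj Y)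
  map_add : ∀ (X Y : C.Obj) (f f' : C.Hom X Y), map (f + f') = map f + map f'
  map_smul : ∀ (X Y : C.Obj) (c : ℂ) (f : C.Hom X Y), map (c • f) = c • map f
  map_comp : ∀ (X Y Z : C.Obj) (g : C.Hom Y Z) (f : C.Hom X Y),
    map (C.comp g f) = D.comp (map g) (map f)
  map_star : ∀ (X Y : C.Obj) (f : C.Hom X Y), map (C.star f) = D.star (map f)

namespace StarFunctor

theorem map_zero {C D : StarCatNu} (F : StarFunctor C D) (X Y : C.Obj) :
    F.map (0 : C.Hom X Y) = 0 :=
  (AddMonoidHom.mk' (fun f : C.Hom X Y => F.map f) (F.map_add X Y)).map_zero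

/-- The identity functor. -/
def id (C : StarCatNu) : StarFunctor C C where
  obj X := X
  map f := f
  map_add _ _ _ _ := rfl
  map_smul _ _ _ _ := rfl
  map_comp _ _ _ _ _ := rfl
  map_star _ _ _ := rfl

/-- Composition of functors: first `F`, then `G`. -/
def comp {C D E : StarCatNu} (F : StarFunctor C D) (G : StarFunctor D E) :
    StarFunctor C E where
  obj X := G.obj (F.obj X)
  map f := G.map (F.map f)
  map_add X Y f f' := by
    show G.map (F.map (f + f')) = G.map (F.map f) + G.map (F.map f')
    rw [F.map_add, G.map_add]
  map_smul X Y c f := by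
    show G.map (F.map (c • f)) = c • G.map (F.map f)
    rw [F.map_smul, G.map_smul]
  map_comp X Y Z g f := by
    show G.map (F.map (C.comp g f)) = E.comp (G.map (F.map g)) (G.map (F.map f))
    rw [F.map_comp, G.map_comp]
  map_star X Y f := by
    show G.map (F.map (C.star f)) = E.star (G.map (F.map f))
    rw [F.map_star, G.map_star]

end StarFunctor

instance : CategoryTheory.Category StarCatNu where
  Hom := StarFunctor
  id := StarFunctor.id
  comp := StarFunctor.comp
  id_comp := by intros; rfl
  comp_id := by intros; rfl
  assoc := by intros; rfl
/-- A possibly non-unital ∗-algebra over ℂ regarded as a ℂ-linear ∗-category with a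
single object. -/
def StarCatNu.ofAlgebra (B : Type) [NonUnitalRing B] [Module ℂ B]
    [SMulCommClass ℂ B B] [IsScalarTower ℂ B B] [StarRing B] [StarModule ℂ B] :
    StarCatNu where
  Obj := PUnit
  Hom _ _ := B
  comp g f := g * f
  star b := Star.star b
  comp_assoc h g f := mul_assoc h g f
  add_comp g g' f := add_mul g g' f
  comp_add g f f' := mul_add g f f'
  smul_comp c g f := smul_mul_assoc c g f
  comp_smul c g f := mul_smul_comm c g f
  star_star f := InvolutiveStar.star_involutive f
  star_comp g f := StarMul.star_mul g f
  star_add f f' := StarAddMonoid.star_add f f'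
  star_smul c f := by
    show Star.star (c • f) = (starRingEnd ℂ) c • Star.star f
    rw [StarModule.star_smul, starRingEnd_apply]

/-- The maximal semi-norm of a morphism in a possibly non-unital ℂ-linear ∗-category:
the supremum of `‖ρ f‖` over all morphisms `ρ` into C*-algebras regarded as one-object
ℂ-linear ∗-categories. -/
noncomputable def StarCatNu.repNorm (C : StarCatNu) {X Y : C.Obj} (f : C.Hom X Y)
    (B : Type) [NonUnitalCStarAlgebra B] (ρ : StarFunctor C (StarCatNu.ofAlgebra B)) : ℝ≥0∞ :=
  (‖id (α := B) (ρ.map f)‖₊ : ℝ≥0∞)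

noncomputable def StarCatNu.maxNorm (C : StarCatNu) {X Y : C.Obj} (f : C.Hom X Y) : ℝ≥0∞ :=
  sSup { r : ℝ≥0∞ | ∃ (B : Type) (i : NonUnitalCStarAlgebra B)
    (ρ : StarFunctor C (StarCatNu.ofAlgebra B)), r = @StarCatNu.repNorm C X Y f B i ρ }

/-- A pre-C*-category: all morphisms have finite maximal semi-norm. -/
def IsPreCStar (C : StarCatNu) : Prop :=
  ∀ (X Y : C.Obj) (f : C.Hom X Y), C.maxNorm f < ⊤

/-- A C*-category: the maximal semi-norm is a finite norm and the morphism spaces are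
complete with respect to it (completeness is expressed via Cauchy sequences). -/
def IsCStar (C : StarCatNu) : Prop :=
  IsPreCStar C ∧
  (∀ (X Y : C.Obj) (f : C.Hom X Y), C.maxNorm f = 0 → f = 0) ∧
  (∀ (X Y : C.Obj) (u : ℕ → C.Hom X Y),
    (∀ ε : ℝ≥0∞, 0 < ε → ∃ N, ∀ m ≥ N, ∀ n ≥ N, C.maxNorm (u m - u n) < ε) →
    ∃ f : C.Hom X Y, ∀ ε : ℝ≥0∞, 0 < ε → ∃ N, ∀ n ≥ N, C.maxNorm (u n - f) < ε)

/-- `e` is an identity morphism at its object. -/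
def IsIdentityAt (C : StarCatNu) {X : C.Obj} (e : C.Hom X X) : Prop :=
  (∀ (Y : C.Obj) (f : C.Hom X Y), C.comp f e = f) ∧
  (∀ (Y : C.Obj) (g : C.Hom Y X), C.comp e g = g)

/-- A ℂ-linear ∗-category is unital if every object admits an identity morphism. -/
def StarCatNu.IsUnital (C : StarCatNu) : Prop :=
  ∀ X : C.Obj, ∃ e : C.Hom X X, IsIdentityAt C e

/-- A functor is unital if it sends identity morphisms to identity morphisms. -/
def StarFunctor.Unital {C D : StarCatNu} (F : StarFunctor C D) : Prop :=
  ∀ (X : C.Obj) (e : C.Hom X X), IsIdentityAt C e → IsIdentityAt D (F.map e)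

/-- A morphism `u` is unitary if `u* ∘ u` and `u ∘ u*` are identity morphisms. -/
def IsUnitary (D : StarCatNu) {A B : D.Obj} (u : D.Hom A B) : Prop :=
  IsIdentityAt D (D.comp (D.star u) u) ∧ IsIdentityAt D (D.comp u (D.star u))

/-- A unitary natural transformation between two functors. -/
structure UnitaryTrans {C D : StarCatNu} (F G : StarFunctor C D) where
  app : ∀ X : C.Obj, D.Hom (F.obj X) (G.obj X)
  natural : ∀ (X Y : C.Obj) (f : C.Hom X Y),
    D.comp (app Y) (F.map f) = D.comp (G.map f) (app X)
  unitary : ∀ X : C.Obj, IsUnitary D (app X)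

/-- A functor is a unitary equivalence if it is invertible up to unitary isomorphism. -/
def IsUnitaryEquiv {C D : StarCatNu} (F : StarFunctor C D) : Prop :=
  ∃ H : StarFunctor D C,
    Nonempty (UnitaryTrans (F.comp H) (StarFunctor.id C)) ∧
    Nonempty (UnitaryTrans (H.comp F) (StarFunctor.id D))

/-- A quotient morphism: bijective on objects and surjective on all morphism spaces. -/
def IsQuotientHom {C D : StarCatNu} (F : StarFunctor C D) : Prop :=
  Function.Bijective F.obj ∧
  ∀ (X Y : C.Obj), Function.Surjective (fun f : C.Hom X Y => F.map f)

/-- An exact sequence `0 → C → D → Q → 0`: `p` is a quotient morphism and `i` is the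
inclusion of its kernel. -/
structure IsExactSeq {C D Q : StarCatNu} (i : StarFunctor C D) (p : StarFunctor D Q) : Prop where
  i_obj_bij : Function.Bijective i.obj
  i_map_inj : ∀ (X Y : C.Obj), Function.Injective (fun f : C.Hom X Y => i.map f)
  p_quot : IsQuotientHom p
  exact : ∀ (X Y : C.Obj) (f : D.Hom (i.obj X) (i.obj Y)),
    p.map f = 0 ↔ ∃ g : C.Hom X Y, i.map g = f

/-- `ι : C → Cc` exhibits the C*-category `Cc` as the completion of the pre-C*-category `C`
with respect to the maximal semi-norm. -/
structure IsCompletion (C Cc : StarCatNu) (ι : StarFunctor C Cc) : Prop where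
  pre : IsPreCStar C
  cstar : IsCStar Cc
  obj_bij : Function.Bijective ι.obj
  isometric : ∀ (X Y : C.Obj) (f : C.Hom X Y), Cc.maxNorm (ι.map f) = C.maxNorm f
  dense : ∀ (X Y : C.Obj) (h : Cc.Hom (ι.obj X) (ι.obj Y)) (ε : ℝ≥0∞), 0 < ε →
    ∃ f : C.Hom X Y, Cc.maxNorm (h - ι.map f) < ε
/-- An action of a group `G` on a possibly non-unital ℂ-linear ∗-category `C` by
automorphisms (an object of `Fun(BG, ∗Cat^nu_ℂ)`). -/
structure GAction (G : Type) [Group G] (C : StarCatNu) where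
  actObj : G → C.Obj → C.Obj
  actMap : ∀ (g : G) {X Y : C.Obj}, C.Hom X Y → C.Hom (actObj g X) (actObj g Y)
  one_obj : ∀ X : C.Obj, actObj 1 X = X
  mul_obj : ∀ (g h : G) (X : C.Obj), actObj g (actObj h X) = actObj (g * h) X
  one_map : ∀ (X Y : C.Obj) (f : C.Hom X Y),
    C.castHom (one_obj X) (one_obj Y) (actMap 1 f) = f
  mul_map : ∀ (g h : G) (X Y : C.Obj) (f : C.Hom X Y),
    C.castHom (mul_obj g h X) (mul_obj g h Y) (actMap g (actMap h f)) = actMap (g * h) f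
  map_add : ∀ (g : G) (X Y : C.Obj) (f f' : C.Hom X Y),
    actMap g (f + f') = actMap g f + actMap g f'
  map_smul : ∀ (g : G) (X Y : C.Obj) (c : ℂ) (f : C.Hom X Y),
    actMap g (c • f) = c • actMap g f
  map_comp : ∀ (g : G) (X Y Z : C.Obj) (u : C.Hom Y Z) (f : C.Hom X Y),
    actMap g (C.comp u f) = C.comp (actMap g u) (actMap g f)
  map_star : ∀ (g : G) (X Y : C.Obj) (f : C.Hom X Y),
    actMap g (C.star f) = C.star (actMap g f)

namespace GAction

variable {G : Type} [Group G] {C : StarCatNu}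

/-- The automorphism of `C` given by the action of `g`. -/
def functor (α : GAction G C) (g : G) : StarFunctor C C where
  obj := α.actObj g
  map := α.actMap g
  map_add := α.map_add g
  map_smul := α.map_smul g
  map_comp := α.map_comp g
  map_star := α.map_star g

theorem inv_mul_obj (α : GAction G C) (g g' : G) (Z : C.Obj) :
    α.actObj g⁻¹ (α.actObj g'⁻¹ Z) = α.actObj (g' * g)⁻¹ Z := by
  rw [α.mul_obj, mul_inv_rev]

theorem cancel_obj (α : GAction G C) (g : G) (Y : C.Obj) :
    α.actObj g (α.actObj g⁻¹ Y) = Y := by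
  rw [α.mul_obj, mul_inv_cancel, α.one_obj]

theorem inv_inv_obj (α : GAction G C) (g : G) (X : C.Obj) :
    α.actObj g⁻¹⁻¹ X = α.actObj g X := by rw [inv_inv]

theorem one_inv_obj (α : GAction G C) (Y : C.Obj) :
    α.actObj (1 : G)⁻¹ Y = Y := by rw [inv_one, α.one_obj]

theorem lc_obj (α : GAction G C) (a b : G) (Y : C.Obj) :
    α.actObj a⁻¹ Y = α.actObj (b⁻¹ * a)⁻¹ (α.actObj b⁻¹ Y) := by
  rw [α.mul_obj]
  congr 1
  group

end GAction

/-- `CG` together with the data `obj`, `ins` is a realization of the algebraic crossed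
product `C ⋊^alg G`: its objects are those of `C`, its morphism spaces are the direct sums
`⊕_{g ∈ G} Hom_C(X, g⁻¹Y)` (the element of the `g`-th summand corresponding to `f` being
`ins g f`, i.e. `(f, g)`), with composition `(f', g') ∘ (f, g) = (g⁻¹f' ∘ f, g'g)` and
involution `(f, g)* = (g f*, g⁻¹)`. -/
structure IsCrossedProductAlg (G : Type) [Group G] (C : StarCatNu) (α : GAction G C)
    (CG : StarCatNu) where
  obj : C.Obj → CG.Obj
  obj_bij : Function.Bijective obj
  ins : ∀ (g : G) {X Y : C.Obj}, C.Hom X (α.actObj g⁻¹ Y) → CG.Hom (obj X) (obj Y)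
  ins_add : ∀ (g : G) (X Y : C.Obj) (f f' : C.Hom X (α.actObj g⁻¹ Y)),
    ins g (f + f') = ins g f + ins g f'
  ins_smul : ∀ (g : G) (X Y : C.Obj) (c : ℂ) (f : C.Hom X (α.actObj g⁻¹ Y)),
    ins g (c • f) = c • ins g f
  ins_comp : ∀ (g g' : G) (X Y Z : C.Obj)
    (f : C.Hom X (α.actObj g⁻¹ Y)) (f' : C.Hom Y (α.actObj g'⁻¹ Z)),
    CG.comp (ins g' f') (ins g f) =
      ins (g' * g) (C.castHom rfl (α.inv_mul_obj g g' Z)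
        (C.comp (α.actMap g⁻¹ f') f))
  ins_star : ∀ (g : G) (X Y : C.Obj) (f : C.Hom X (α.actObj g⁻¹ Y)),
    CG.star (ins g f) =
      ins g⁻¹ (C.castHom (α.cancel_obj g Y) (α.inv_inv_obj g X).symm
        (α.actMap g (C.star f)))
  span : ∀ (X Y : C.Obj) (u : CG.Hom (obj X) (obj Y)),
    ∃ (s : Finset G) (φ : ∀ g : G, C.Hom X (α.actObj g⁻¹ Y)),
      u = s.sum fun g => ins g (φ g)
  indep : ∀ (X Y : C.Obj) (s : Finset G) (φ : ∀ g : G, C.Hom X (α.actObj g⁻¹ Y)),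
    (s.sum fun g => ins g (φ g)) = 0 → ∀ g ∈ s, φ g = 0

/-- The maximal semi-norm of an element of a possibly non-unital ∗-algebra over ℂ:
the supremum of `‖φ x‖` over all ∗-homomorphisms `φ` into C*-algebras. -/
noncomputable def algRepNorm (R : Type) [NonUnitalRing R] [Module ℂ R]
    [SMulCommClass ℂ R R] [IsScalarTower ℂ R R] [StarRing R] [StarModule ℂ R]
    (x : R) (B : Type) [NonUnitalCStarAlgebra B] (φ : R →⋆ₙₐ[ℂ] B) : ℝ≥0∞ :=
  (‖φ x‖₊ : ℝ≥0∞)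

/-- The maximal semi-norm on a ∗-algebra over ℂ. -/
noncomputable def algMaxNorm (R : Type) [NonUnitalRing R] [Module ℂ R]
    [SMulCommClass ℂ R R] [IsScalarTower ℂ R R] [StarRing R] [StarModule ℂ R]
    (x : R) : ℝ≥0∞ :=
  sSup { r : ℝ≥0∞ | ∃ (B : Type) (i : NonUnitalCStarAlgebra B) (φ : R →⋆ₙₐ[ℂ] B),
    r = @algRepNorm R _ _ _ _ _ _ x B i φ }

/-- A ∗-algebra over ℂ is a pre-C*-algebra if all its elements have finite maximal
semi-norm. -/
def IsPreCStarAlg (R : Type) [NonUnitalRing R] [Module ℂ R]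
    [SMulCommClass ℂ R R] [IsScalarTower ℂ R R] [StarRing R] [StarModule ℂ R] : Prop :=
  ∀ x : R, algMaxNorm R x < ⊤

/-- `j : R → R̄` exhibits the C*-algebra `R̄` as the completion of the pre-C*-algebra `R`
with respect to the maximal semi-norm. -/
structure IsAlgCompletion (R : Type) [NonUnitalRing R] [Module ℂ R]
    [SMulCommClass ℂ R R] [IsScalarTower ℂ R R] [StarRing R] [StarModule ℂ R]
    (R' : Type) [NonUnitalCStarAlgebra R'] (j : R →⋆ₙₐ[ℂ] R') : Prop where
  isometric : ∀ x : R, (‖j x‖₊ : ℝ≥0∞) = algMaxNorm R x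
  dense : DenseRange j

/-- `A`, together with the family `ι` (sending a morphism `f` to the element `[f]`), is a
realization of the ∗-algebra `A^alg(C)`: the direct sum `⊕_{X,Y ∈ Ob(C)} Hom_C(X, Y)`,
with product `[g][f] = [g ∘ f]` when the morphisms are composable and `0` otherwise, and
involution `[f]* = [f*]`. -/
structure IsAAlg (C : StarCatNu) (A : Type) [NonUnitalRing A] [Module ℂ A]
    [SMulCommClass ℂ A A] [IsScalarTower ℂ A A] [StarRing A] [StarModule ℂ A] where
  ι : ∀ {X Y : C.Obj}, C.Hom X Y → A
  ι_add : ∀ (X Y : C.Obj) (f f' : C.Hom X Y), ι (f + f') = ι f + ι f'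
  ι_smul : ∀ (X Y : C.Obj) (c : ℂ) (f : C.Hom X Y), ι (c • f) = c • ι f
  ι_mul_comp : ∀ (X Y Z : C.Obj) (g : C.Hom Y Z) (f : C.Hom X Y),
    ι g * ι f = ι (C.comp g f)
  ι_mul_ne : ∀ (X Y X' Y' : C.Obj) (g : C.Hom X' Y') (f : C.Hom X Y),
    Y ≠ X' → ι g * ι f = 0
  ι_star : ∀ (X Y : C.Obj) (f : C.Hom X Y), star (ι f) = ι (C.star f)
  span : ∀ a : A, ∃ (s : Finset (C.Obj × C.Obj)) (φ : ∀ p : C.Obj × C.Obj, C.Hom p.1 p.2),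
    a = s.sum fun p => ι (φ p)
  indep : ∀ (s : Finset (C.Obj × C.Obj)) (φ : ∀ p : C.Obj × C.Obj, C.Hom p.1 p.2),
    (s.sum fun p => ι (φ p)) = 0 → ∀ p ∈ s, φ p = 0

/-- An action of a group `G` on a ∗-algebra over ℂ by ∗-automorphisms. -/
structure AlgGAction (G : Type) [Group G] (A : Type) [NonUnitalRing A] [Module ℂ A]
    [SMulCommClass ℂ A A] [IsScalarTower ℂ A A] [StarRing A] [StarModule ℂ A] where
  act : G → A → A
  one_act : ∀ a : A, act 1 a = a
  mul_act : ∀ (g h : G) (a : A), act g (act h a) = act (g * h) a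
  map_add : ∀ (g : G) (a b : A), act g (a + b) = act g a + act g b
  map_smul : ∀ (g : G) (c : ℂ) (a : A), act g (c • a) = c • act g a
  map_mul : ∀ (g : G) (a b : A), act g (a * b) = act g a * act g b
  map_star : ∀ (g : G) (a : A), act g (star a) = star (act g a)

/-- `R`, together with the maps `ins g : A → R` (written `a ↦ (a, g)`), is a realization
of the algebraic crossed product `A ⋊^alg G`: underlying vector space `⊕_{g ∈ G} A`,
multiplication `(a', g') (a, g) = ((g⁻¹ a') a, g' g)` and involution
`(a, g)* = (g a*, g⁻¹)`. -/
structure IsAlgCrossedProduct (G : Type) [Group G] (A : Type) [NonUnitalRing A]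
    [Module ℂ A] [SMulCommClass ℂ A A] [IsScalarTower ℂ A A] [StarRing A] [StarModule ℂ A]
    (τ : AlgGAction G A)
    (R : Type) [NonUnitalRing R] [Module ℂ R] [SMulCommClass ℂ R R] [IsScalarTower ℂ R R]
    [StarRing R] [StarModule ℂ R] where
  ins : G → A → R
  ins_add : ∀ (g : G) (a b : A), ins g (a + b) = ins g a + ins g b
  ins_smul : ∀ (g : G) (c : ℂ) (a : A), ins g (c • a) = c • ins g a
  ins_mul : ∀ (g g' : G) (a a' : A),
    ins g' a' * ins g a = ins (g' * g) (τ.act g⁻¹ a' * a)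
  ins_star : ∀ (g : G) (a : A), star (ins g a) = ins g⁻¹ (τ.act g (star a))
  span : ∀ x : R, ∃ (s : Finset G) (φ : G → A), x = s.sum fun g => ins g (φ g)
  indep : ∀ (s : Finset G) (φ : G → A),
    (s.sum fun g => ins g (φ g)) = 0 → ∀ g ∈ s, φ g = 0

open scoped MultiplierAlgebra in
/-- A covariant representation of the C*-algebra `A` with `G`-action `τ` on the
C*-algebra `D`: a ∗-homomorphism `ρ : A → D` together with a group homomorphism
`μ : G → U(M(D))` into the unitary group of the multiplier algebra of `D` such that
`μ(g) ρ(a) μ(g)⁻¹ = ρ(g a)` for all `g` and `a`. -/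
def IsCovariantPair {G : Type} [Group G] {A : Type} [NonUnitalCStarAlgebra A]
    (τ : AlgGAction G A) {D : Type} [NonUnitalCStarAlgebra D]
    (ρ : A →⋆ₙₐ[ℂ] D) (μ : G →* unitary 𝓜(ℂ, D)) : Prop :=
  ∀ (g : G) (a : A),
    (μ g : 𝓜(ℂ, D)) * (ρ a : 𝓜(ℂ, D)) * ((μ g⁻¹ : unitary 𝓜(ℂ, D)) : 𝓜(ℂ, D)) =
      ((ρ (τ.act g a) : D) : 𝓜(ℂ, D))



theorem aux_exists_lin {I : Type} {M : I → Type} [∀ i, AddCommGroup (M i)] [∀ i, Module ℂ (M i)]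
    {N B : Type} [AddCommGroup N] [Module ℂ N] [AddCommGroup B] [Module ℂ B]
    (ins : ∀ i, M i →ₗ[ℂ] N)
    (span : ∀ x : N, ∃ (s : Finset I) (φ : ∀ i, M i), x = s.sum fun i => ins i (φ i))
    (indep : ∀ (s : Finset I) (φ : ∀ i, M i),
      (s.sum fun i => ins i (φ i)) = 0 → ∀ i ∈ s, φ i = 0)
    (L : ∀ i, M i →ₗ[ℂ] B) :
    ∃ Φ : N →ₗ[ℂ] B, ∀ i x, Φ (ins i x) = L i x := by
  classical
  let T : (Π₀ i, M i) →ₗ[ℂ] N := DFinsupp.lsum ℂ ins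
  have hT : ∀ i x, T (DFinsupp.single i x) = ins i x := fun i x => by
    simp [T]
  have hb : Function.Bijective T := by
    constructor
    · rw [injective_iff_map_eq_zero]
      intro φ h
      have h2 : T φ = φ.support.sum fun i => ins i (φ i) := by
        simp only [T, DFinsupp.lsum_apply_apply, DFinsupp.sumAddHom_apply]
        rfl
      rw [h2] at h
      have h3 := indep _ _ h
      ext i
      by_cases hi : i ∈ φ.support
      · exact h3 i hi
      · simpa using hi
    · intro x
      obtain ⟨s, φ, rfl⟩ := span x
      refine ⟨s.sum fun i => DFinsupp.single i (φ i), ?_⟩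
      rw [map_sum]
      exact Finset.sum_congr rfl fun i _ => hT i _
  let E := LinearEquiv.ofBijective T hb
  refine ⟨(DFinsupp.lsum ℂ L).comp E.symm.toLinearMap, fun i x => ?_⟩
  have : E.symm (ins i x) = DFinsupp.single i x := by
    rw [LinearEquiv.symm_apply_eq]
    exact (hT i x).symm
  simp [this]

/-- A representation of a ∗-category on a C*-algebra. -/
structure CatRep (C : StarCatNu) (B : Type) [NonUnitalCStarAlgebra B] where
  map : ∀ X Y, C.Hom X Y → B
  map_add : ∀ (X Y : C.Obj) (f f' : C.Hom X Y), map _ _ (f + f') = map _ _ f + map _ _ f'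
  map_smul : ∀ (X Y : C.Obj) (c : ℂ) (f : C.Hom X Y), map _ _ (c • f) = c • map _ _ f
  map_comp : ∀ (X Y Z : C.Obj) (g : C.Hom Y Z) (f : C.Hom X Y),
    map _ _ (C.comp g f) = map _ _ g * map _ _ f
  map_star : ∀ (X Y : C.Obj) (f : C.Hom X Y), map _ _ (C.star f) = star (map _ _ f)

namespace CatRep

variable {C : StarCatNu} {B : Type} [NonUnitalCStarAlgebra B]

/-- The functor associated with a representation. -/
def toFunctor (F : CatRep C B) : StarFunctor C (StarCatNu.ofAlgebra B) where
  obj _ := PUnit.unit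
  map f := F.map _ _ f
  map_add := F.map_add
  map_smul := F.map_smul
  map_comp := F.map_comp
  map_star := F.map_star

/-- The representation associated with a functor. -/
def ofFunctor (F : StarFunctor C (StarCatNu.ofAlgebra B)) : CatRep C B where
  map _ _ f := F.map f
  map_add := F.map_add
  map_smul := F.map_smul
  map_comp := F.map_comp
  map_star := F.map_star

/-- The linear map given by a representation. -/
def lin (F : CatRep C B) (X Y : C.Obj) : C.Hom X Y →ₗ[ℂ] B where
  toFun := F.map X Y
  map_add' := F.map_add X Y
  map_smul' := F.map_smul X Y

theorem map_sub (F : CatRep C B) {X Y : C.Obj} (f f' : C.Hom X Y) :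
    F.map _ _ (f - f') = F.map _ _ f - F.map _ _ f' := _root_.map_sub (F.lin X Y) f f'

theorem enorm_le (F : CatRep C B) {X Y : C.Obj} (f : C.Hom X Y) :
    ‖F.map _ _ f‖ₑ ≤ C.maxNorm f :=
  le_sSup ⟨B, inferInstance, F.toFunctor, rfl⟩

end CatRep

namespace StarCatNu

variable {C : StarCatNu} {X Y Z : C.Obj}

theorem maxNorm_le {X Y : C.Obj} {f : C.Hom X Y} {r : ℝ≥0∞}
    (h : ∀ (B : Type) [NonUnitalCStarAlgebra B] (F : CatRep C B), ‖F.map _ _ f‖ₑ ≤ r) :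
    C.maxNorm f ≤ r := by
  apply sSup_le
  rintro _ ⟨B, i, ρ, rfl⟩
  exact h B (CatRep.ofFunctor ρ)

theorem maxNorm_add_le {X Y : C.Obj} (f g : C.Hom X Y) :
    C.maxNorm (f + g) ≤ C.maxNorm f + C.maxNorm g :=
  maxNorm_le fun B _ F => by
    rw [F.map_add]
    exact (enorm_add_le _ _).trans (add_le_add (F.enorm_le f) (F.enorm_le g))

theorem maxNorm_sub_comm {X Y : C.Obj} (f g : C.Hom X Y) :
    C.maxNorm (f - g) ≤ C.maxNorm (g - f) :=
  maxNorm_le fun B _ F => by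
    refine le_trans (le_of_eq ?_) (F.enorm_le (g - f))
    rw [F.map_sub, F.map_sub, ← enorm_neg]
    simp

theorem maxNorm_smul_le {X Y : C.Obj} (c : ℂ) (f : C.Hom X Y) :
    C.maxNorm (c • f) ≤ ‖c‖ₑ * C.maxNorm f :=
  maxNorm_le fun B _ F => by
    rw [F.map_smul, enorm_smul]
    gcongr
    exact F.enorm_le f

theorem maxNorm_star_le {X Y : C.Obj} (f : C.Hom X Y) :
    C.maxNorm (C.star f) ≤ C.maxNorm f :=
  maxNorm_le fun B _ F => by
    refine le_trans (le_of_eq ?_) (F.enorm_le f)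
    rw [F.map_star, ← ofReal_norm, norm_star, ofReal_norm]

theorem maxNorm_comp_le {X Y Z : C.Obj} (g : C.Hom Y Z) (f : C.Hom X Y) :
    C.maxNorm (C.comp g f) ≤ C.maxNorm g * C.maxNorm f :=
  maxNorm_le fun B _ F => by
    rw [F.map_comp]
    refine le_trans ?_ (mul_le_mul' (F.enorm_le g) (F.enorm_le f))
    rw [enorm_eq_nnnorm, enorm_eq_nnnorm, enorm_eq_nnnorm, ← ENNReal.coe_mul]
    exact ENNReal.coe_le_coe.2 (nnnorm_mul_le _ _)

theorem comp_sub (g : C.Hom Y Z) (f f' : C.Hom X Y) :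
    C.comp g (f - f') = C.comp g f - C.comp g f' :=
  (AddMonoidHom.mk' (fun f : C.Hom X Y => C.comp g f) (C.comp_add g)).map_sub f f'

theorem sub_comp (g g' : C.Hom Y Z) (f : C.Hom X Y) :
    C.comp (g - g') f = C.comp g f - C.comp g' f :=
  (AddMonoidHom.mk' (fun g : C.Hom Y Z => C.comp g f) (fun a b => C.add_comp a b f)).map_sub g g'

theorem star_sub (f f' : C.Hom X Y) :
    C.star (f - f') = C.star f - C.star f' :=
  (AddMonoidHom.mk' (fun f : C.Hom X Y => C.star f) C.star_add).map_sub f f'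

theorem comp_sum {I : Type} (s : Finset I) (g : C.Hom Y Z) (f : I → C.Hom X Y) :
    C.comp g (s.sum f) = s.sum fun i => C.comp g (f i) :=
  map_sum (AddMonoidHom.mk' (fun f : C.Hom X Y => C.comp g f) (C.comp_add g)) f s

theorem sum_comp {I : Type} (s : Finset I) (g : I → C.Hom Y Z) (f : C.Hom X Y) :
    C.comp (s.sum g) f = s.sum fun i => C.comp (g i) f :=
  map_sum (AddMonoidHom.mk' (fun g : C.Hom Y Z => C.comp g f) (fun a b => C.add_comp a b f)) g s

theorem star_sum {I : Type} (s : Finset I) (f : I → C.Hom X Y) :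
    C.star (s.sum f) = s.sum fun i => C.star (f i) :=
  map_sum (AddMonoidHom.mk' (fun f : C.Hom X Y => C.star f) C.star_add) f s

end StarCatNu

theorem aux_exists_rep (D : StarCatNu) {O : Type} (e : O → D.Obj) (he : Function.Bijective e)
    (B : Type) [NonUnitalCStarAlgebra B] (m : ∀ X Y, D.Hom (e X) (e Y) → B)
    (m_add : ∀ X Y (f f' : D.Hom (e X) (e Y)), m _ _ (f + f') = m _ _ f + m _ _ f')
    (m_smul : ∀ X Y (c : ℂ) (f : D.Hom (e X) (e Y)), m _ _ (c • f) = c • m _ _ f)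
    (m_comp : ∀ X Y Z (g : D.Hom (e Y) (e Z)) (f : D.Hom (e X) (e Y)),
      m _ _ (D.comp g f) = m _ _ g * m _ _ f)
    (m_star : ∀ X Y (f : D.Hom (e X) (e Y)), m _ _ (D.star f) = star (m _ _ f)) :
    ∃ F : CatRep D B, ∀ X Y (f : D.Hom (e X) (e Y)), F.map _ _ f = m X Y f := by
  choose r hr using he.2
  let M : ∀ X Y : D.Obj, D.Hom X Y → B := fun X Y f =>
    m (r X) (r Y) (D.castHom (hr X).symm (hr Y).symm f)
  have hM : ∀ X Y (f : D.Hom (e X) (e Y)), M _ _ f = m X Y f := by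
    intro X Y f
    have key : ∀ X' Y' (hX : X' = X) (hY : Y' = Y) (pX : e X = e X') (pY : e Y = e Y'),
        m X' Y' (D.castHom pX pY f) = m X Y f := by
      rintro _ _ rfl rfl _ _
      rfl
    exact key _ _ (he.1 (hr _)) (he.1 (hr _)) _ _
  refine ⟨⟨M, ?_, ?_, ?_, ?_⟩, hM⟩
  · intro X Y
    obtain ⟨X, rfl⟩ := he.2 X
    obtain ⟨Y, rfl⟩ := he.2 Y
    intro f f'
    simp only [hM, m_add]
  · intro X Y
    obtain ⟨X, rfl⟩ := he.2 X
    obtain ⟨Y, rfl⟩ := he.2 Y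
    intro f f'
    simp only [hM, m_smul]
  · intro X Y Z
    obtain ⟨X, rfl⟩ := he.2 X
    obtain ⟨Y, rfl⟩ := he.2 Y
    obtain ⟨Z, rfl⟩ := he.2 Z
    intro f f'
    simp only [hM, m_comp]
  · intro X Y
    obtain ⟨X, rfl⟩ := he.2 X
    obtain ⟨Y, rfl⟩ := he.2 Y
    intro f
    simp only [hM, m_star]

/-- Non-composable morphisms multiply to zero. -/
def CatRep.Orth {C : StarCatNu} {B : Type} [NonUnitalCStarAlgebra B] (F : CatRep C B) : Prop :=
  ∀ (X Y X' Y' : C.Obj) (g : C.Hom X' Y') (f : C.Hom X Y), Y ≠ X' →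
    F.map _ _ g * F.map _ _ f = 0

section Completion

open Filter Topology

theorem IsCompletion.exists_seq {C D : StarCatNu} {κ : StarFunctor C D} (hκ : IsCompletion C D κ)
    {X Y : C.Obj} (h : D.Hom (κ.obj X) (κ.obj Y)) :
    ∃ u : ℕ → C.Hom X Y, Tendsto (fun n => D.maxNorm (h - κ.map (u n))) atTop (𝓝 0) := by
  have : ∀ n : ℕ, ∃ f : C.Hom X Y, D.maxNorm (h - κ.map f) < ((n : ℝ≥0∞) + 1)⁻¹ := fun n =>
    hκ.dense X Y h _ (by simp)
  choose u hu using this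
  refine ⟨u, tendsto_of_tendsto_of_tendsto_of_le_of_le tendsto_const_nhds ?_
    (fun _ => zero_le) (fun n => (hu n).le)⟩
  have := (tendsto_add_atTop_iff_nat 1).2 ENNReal.tendsto_inv_nat_nhds_zero
  simpa using this

theorem StarFunctor.map_sub' {C D : StarCatNu} (κ : StarFunctor C D) {X Y : C.Obj}
    (f f' : C.Hom X Y) : κ.map (f - f') = κ.map f - κ.map f' :=
  (AddMonoidHom.mk' (fun f : C.Hom X Y => κ.map f) (κ.map_add X Y)).map_sub f f'

theorem IsCompletion.enorm_sub_le {C D : StarCatNu} {κ : StarFunctor C D}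
    (hκ : IsCompletion C D κ) {B : Type} [NonUnitalCStarAlgebra B] (F : CatRep C B)
    {X Y : C.Obj} (h : D.Hom (κ.obj X) (κ.obj Y)) (u v : C.Hom X Y) :
    ‖F.map _ _ u - F.map _ _ v‖ₑ ≤ D.maxNorm (h - κ.map u) + D.maxNorm (h - κ.map v) := by
  rw [← F.map_sub]
  refine (F.enorm_le _).trans ?_
  rw [← hκ.isometric, κ.map_sub']
  have : κ.map u - κ.map v = (κ.map u - h) + (h - κ.map v) := by abel
  rw [this]
  exact (StarCatNu.maxNorm_add_le _ _).trans
    (add_le_add (StarCatNu.maxNorm_sub_comm _ _) le_rfl)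

theorem IsCompletion.exists_lim {C D : StarCatNu} {κ : StarFunctor C D}
    (hκ : IsCompletion C D κ) {B : Type} [NonUnitalCStarAlgebra B] (F : CatRep C B)
    {X Y : C.Obj} (h : D.Hom (κ.obj X) (κ.obj Y)) :
    ∃ b : B, ∀ u : ℕ → C.Hom X Y, Tendsto (fun n => D.maxNorm (h - κ.map (u n))) atTop (𝓝 0) →
      Tendsto (fun n => F.map _ _ (u n)) atTop (𝓝 b) := by
  obtain ⟨u, hu⟩ := hκ.exists_seq h
  have hc : CauchySeq (fun n => F.map _ _ (u n)) := by
    rw [EMetric.cauchySeq_iff]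
    intro ε hε
    have h2 : (0 : ℝ≥0∞) < ε / 2 := ENNReal.half_pos hε.ne'
    obtain ⟨N, hN⟩ := eventually_atTop.1 (hu.eventually_lt_const h2)
    refine ⟨N, fun m hm n hn => ?_⟩
    rw [edist_eq_enorm_sub]
    refine (hκ.enorm_sub_le F h _ _).trans_lt ?_
    rw [← ENNReal.add_halves ε]
    exact ENNReal.add_lt_add (hN m hm) (hN n hn)
  obtain ⟨b, hb⟩ := cauchySeq_tendsto_of_complete hc
  refine ⟨b, fun v hv => ?_⟩
  have h0 : Tendsto (fun n => F.map _ _ (v n) - F.map _ _ (u n)) atTop (𝓝 0) := by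
    rw [tendsto_zero_iff_enorm_tendsto_zero]
    refine tendsto_of_tendsto_of_tendsto_of_le_of_le tendsto_const_nhds ?_
      (fun _ => zero_le) (fun n => hκ.enorm_sub_le F h _ _)
    simpa using hv.add hu
  simpa using h0.add hb

theorem IsCompletion.exists_extend {C D : StarCatNu} {κ : StarFunctor C D}
    (hκ : IsCompletion C D κ) {B : Type} [NonUnitalCStarAlgebra B] (F : CatRep C B)
    (hF : F.Orth) :
    ∃ F' : CatRep D B, F'.Orth ∧ ∀ X Y (f : C.Hom X Y), F'.map _ _ (κ.map f) = F.map _ _ f := by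
  choose m hm using fun (X Y : C.Obj) (h : D.Hom (κ.obj X) (κ.obj Y)) => hκ.exists_lim F h
  have key : ∃ F' : CatRep D B, ∀ X Y (f : D.Hom (κ.obj X) (κ.obj Y)),
      F'.map _ _ f = m X Y f := by
    refine aux_exists_rep D κ.obj hκ.obj_bij B m ?_ ?_ ?_ ?_
    · intro X Y f f'
      obtain ⟨u, hu⟩ := hκ.exists_seq f
      obtain ⟨v, hv⟩ := hκ.exists_seq f'
      refine tendsto_nhds_unique (hm _ _ (f + f') (fun n => u n + v n) ?_) ?_
      · refine tendsto_of_tendsto_of_tendsto_of_le_of_le tendsto_const_nhds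
          (h := fun n => D.maxNorm (f - κ.map (u n)) + D.maxNorm (f' - κ.map (v n))) ?_
          (fun _ => zero_le) (fun n => ?_)
        · simpa using hu.add hv
        · refine le_trans (le_of_eq ?_) (StarCatNu.maxNorm_add_le _ _)
          rw [κ.map_add]
          congr 1
          abel
      · simp only [F.map_add]
        exact (hm _ _ f u hu).add (hm _ _ f' v hv)
    · intro X Y c f
      obtain ⟨u, hu⟩ := hκ.exists_seq f
      refine tendsto_nhds_unique (hm _ _ (c • f) (fun n => c • u n) ?_) ?_
      · refine tendsto_of_tendsto_of_tendsto_of_le_of_le tendsto_const_nhds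
          (h := fun n => ‖c‖ₑ * D.maxNorm (f - κ.map (u n))) ?_
          (fun _ => zero_le) (fun n => ?_)
        · simpa using ENNReal.Tendsto.const_mul hu (Or.inr (enorm_ne_top (x := c)))
        · refine le_trans (le_of_eq ?_) (StarCatNu.maxNorm_smul_le _ _)
          rw [κ.map_smul, smul_sub]
      · simp only [F.map_smul]
        exact (hm _ _ f u hu).const_smul c
    · intro X Y Z g f
      obtain ⟨u, hu⟩ := hκ.exists_seq f
      obtain ⟨v, hv⟩ := hκ.exists_seq g
      refine tendsto_nhds_unique (hm _ _ (D.comp g f) (fun n => C.comp (v n) (u n)) ?_) ?_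
      · have hg := hκ.cstar.1 _ _ g
        have hf := hκ.cstar.1 _ _ f
        refine tendsto_of_tendsto_of_tendsto_of_le_of_le tendsto_const_nhds
          (h := fun n => D.maxNorm (g - κ.map (v n)) * D.maxNorm f +
            (D.maxNorm g + D.maxNorm (g - κ.map (v n))) * D.maxNorm (f - κ.map (u n))) ?_
          (fun _ => zero_le) (fun n => ?_)
        · have h1 := ENNReal.Tendsto.mul_const hv (Or.inr hf.ne)
          have h2 := ENNReal.Tendsto.mul (hv.const_add (D.maxNorm g)) (Or.inr (by simp)) hu
            (Or.inr (by simpa using hg.ne))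
          simpa using h1.add h2
        · have h1 : D.comp g f - κ.map (C.comp (v n) (u n)) =
              D.comp (g - κ.map (v n)) f + D.comp (κ.map (v n)) (f - κ.map (u n)) := by
            rw [κ.map_comp, StarCatNu.comp_sub, StarCatNu.sub_comp]
            abel
          have h2 : D.maxNorm (κ.map (v n)) ≤ D.maxNorm g + D.maxNorm (g - κ.map (v n)) := by
            have : κ.map (v n) = g + (κ.map (v n) - g) := by abel
            calc D.maxNorm (κ.map (v n)) = D.maxNorm (g + (κ.map (v n) - g)) := by rw [← this]
              _ ≤ _ := (StarCatNu.maxNorm_add_le _ _).trans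
                (add_le_add le_rfl (StarCatNu.maxNorm_sub_comm _ _))
          rw [h1]
          refine (StarCatNu.maxNorm_add_le _ _).trans (add_le_add (StarCatNu.maxNorm_comp_le _ _)
            ((StarCatNu.maxNorm_comp_le _ _).trans (mul_le_mul' h2 le_rfl)))
      · simp only [F.map_comp]
        exact (hm _ _ g v hv).mul (hm _ _ f u hu)
    · intro X Y f
      obtain ⟨u, hu⟩ := hκ.exists_seq f
      refine tendsto_nhds_unique (hm _ _ (D.star f) (fun n => C.star (u n)) ?_) ?_
      · refine tendsto_of_tendsto_of_tendsto_of_le_of_le tendsto_const_nhds hu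
          (fun _ => zero_le) (fun n => ?_)
        refine le_trans (le_of_eq ?_) (StarCatNu.maxNorm_star_le _)
        rw [κ.map_star, StarCatNu.star_sub]
      · simp only [F.map_star]
        exact (hm _ _ f u hu).star
  obtain ⟨F', hF'⟩ := key
  refine ⟨F', ?_, ?_⟩
  · intro X Y X' Y'
    obtain ⟨X, rfl⟩ := hκ.obj_bij.2 X
    obtain ⟨Y, rfl⟩ := hκ.obj_bij.2 Y
    obtain ⟨X', rfl⟩ := hκ.obj_bij.2 X'
    obtain ⟨Y', rfl⟩ := hκ.obj_bij.2 Y'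
    intro g f hne
    obtain ⟨u, hu⟩ := hκ.exists_seq f
    obtain ⟨v, hv⟩ := hκ.exists_seq g
    rw [hF', hF']
    refine tendsto_nhds_unique ((hm _ _ g v hv).mul (hm _ _ f u hu)) ?_
    have : ∀ n, F.map _ _ (v n) * F.map _ _ (u n) = 0 := fun n =>
      hF _ _ _ _ _ _ (fun h => hne (by rw [h]))
    simp [this]
  · intro X Y f
    rw [hF']
    have h0 : D.maxNorm (κ.map f - κ.map f) = 0 := by
      rw [sub_self, ← nonpos_iff_eq_zero]
      exact StarCatNu.maxNorm_le fun B _ F => by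
        rw [show F.map _ _ (0 : D.Hom (κ.obj X) (κ.obj Y)) = 0 from _root_.map_zero (F.lin _ _)]
        simp
    exact (tendsto_nhds_unique (hm _ _ (κ.map f) (fun _ => f) (by
      simp only [h0]; exact tendsto_const_nhds))
      tendsto_const_nhds)

end Completion

theorem IsAAlg.exists_hom {C : StarCatNu} {A : Type} [NonUnitalRing A] [Module ℂ A]
    [SMulCommClass ℂ A A] [IsScalarTower ℂ A A] [StarRing A] [StarModule ℂ A] (w : IsAAlg C A)
    {B : Type} [NonUnitalCStarAlgebra B] (F : CatRep C B) (hF : F.Orth) :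
    ∃ Φ : A →⋆ₙₐ[ℂ] B, ∀ X Y (f : C.Hom X Y), Φ (w.ι f) = F.map _ _ f := by
  obtain ⟨Φ, hΦ⟩ := aux_exists_lin (I := C.Obj × C.Obj) (M := fun p => C.Hom p.1 p.2)
    (fun p => { toFun := fun f => w.ι f, map_add' := w.ι_add _ _, map_smul' := w.ι_smul _ _ })
    w.span w.indep (fun p => F.lin p.1 p.2)
  have hΦ' : ∀ X Y (f : C.Hom X Y), Φ (w.ι f) = F.map _ _ f := fun X Y f => hΦ (X, Y) f
  have hmul : ∀ a b, Φ (a * b) = Φ a * Φ b := by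
    intro a b
    obtain ⟨s, φ, rfl⟩ := w.span a
    obtain ⟨t, ψ, rfl⟩ := w.span b
    simp only [Finset.sum_mul_sum, map_sum]
    refine Finset.sum_congr rfl fun p _ => Finset.sum_congr rfl fun q _ => ?_
    rw [hΦ', hΦ']
    obtain ⟨X', Y'⟩ := p
    obtain ⟨X, Y⟩ := q
    by_cases h : Y = X'
    · subst h
      rw [w.ι_mul_comp, hΦ', F.map_comp]
    · rw [w.ι_mul_ne _ _ _ _ _ _ h, hF _ _ _ _ _ _ h, map_zero]
  have hstar : ∀ a, Φ (star a) = star (Φ a) := by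
    intro a
    obtain ⟨s, φ, rfl⟩ := w.span a
    simp only [_root_.star_sum, map_sum, w.ι_star, hΦ', F.map_star]
  exact ⟨{ toFun := Φ, map_smul' := fun c x => Φ.map_smul c x, map_zero' := Φ.map_zero,
           map_add' := Φ.map_add, map_mul' := hmul, map_star' := hstar }, hΦ'⟩

theorem IsAAlg.ι_castHom {C : StarCatNu} {A : Type} [NonUnitalRing A] [Module ℂ A]
    [SMulCommClass ℂ A A] [IsScalarTower ℂ A A] [StarRing A] [StarModule ℂ A] (w : IsAAlg C A)
    {X X' Y Y' : C.Obj} (hX : X = X') (hY : Y = Y') (f : C.Hom X Y) :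
    w.ι (C.castHom hX hY f) = w.ι f := by
  subst hX hY
  rfl

/-- The representation of the algebraic crossed product on a C*-algebra. -/
theorem IsCrossedProductAlg.exists_rep {G : Type} [Group G] {C : StarCatNu} {α : GAction G C}
    {CG : StarCatNu} (hCG : IsCrossedProductAlg G C α CG) {B : Type} [NonUnitalCStarAlgebra B]
    (L : ∀ (g : G) (X Y : C.Obj), C.Hom X (α.actObj g⁻¹ Y) →ₗ[ℂ] B)
    (L_comp : ∀ (g g' : G) (X Y Z : C.Obj)
      (f : C.Hom X (α.actObj g⁻¹ Y)) (f' : C.Hom Y (α.actObj g'⁻¹ Z)),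
      L g' _ _ f' * L g _ _ f = L (g' * g) _ _ (C.castHom rfl (α.inv_mul_obj g g' Z)
        (C.comp (α.actMap g⁻¹ f') f)))
    (L_ne : ∀ (g g' : G) (X Y Y' Z : C.Obj)
      (f : C.Hom X (α.actObj g⁻¹ Y)) (f' : C.Hom Y' (α.actObj g'⁻¹ Z)), Y ≠ Y' →
      L g' _ _ f' * L g _ _ f = 0)
    (L_star : ∀ (g : G) (X Y : C.Obj) (f : C.Hom X (α.actObj g⁻¹ Y)),
      star (L g _ _ f) = L g⁻¹ _ _ (C.castHom (α.cancel_obj g Y) (α.inv_inv_obj g X).symm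
        (α.actMap g (C.star f)))) :
    ∃ F : CatRep CG B, F.Orth ∧ ∀ g X Y (f : C.Hom X (α.actObj g⁻¹ Y)),
      F.map _ _ (hCG.ins g f) = L g X Y f := by
  have : ∀ X Y : C.Obj, ∃ Φ : CG.Hom (hCG.obj X) (hCG.obj Y) →ₗ[ℂ] B,
      ∀ g (f : C.Hom X (α.actObj g⁻¹ Y)), Φ (hCG.ins g f) = L g X Y f := fun X Y =>
    aux_exists_lin (I := G) (M := fun g => C.Hom X (α.actObj g⁻¹ Y))
      (fun g => { toFun := fun f => hCG.ins g f, map_add' := hCG.ins_add g _ _,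
                  map_smul' := hCG.ins_smul g _ _ })
      (hCG.span X Y) (hCG.indep X Y) (fun g => L g X Y)
  choose Φ hΦ using this
  have key : ∃ F : CatRep CG B, ∀ X Y (f : CG.Hom (hCG.obj X) (hCG.obj Y)),
      F.map _ _ f = Φ X Y f := by
    refine aux_exists_rep CG hCG.obj hCG.obj_bij B (fun X Y f => Φ X Y f)
      (fun X Y => map_add _) (fun X Y => map_smul _) ?_ ?_
    · intro X Y Z g f
      obtain ⟨s, φ, rfl⟩ := hCG.span _ _ g
      obtain ⟨t, ψ, rfl⟩ := hCG.span _ _ f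
      simp only [StarCatNu.comp_sum, StarCatNu.sum_comp, map_sum, hΦ, Finset.sum_mul_sum,
        hCG.ins_comp, L_comp]
      rw [Finset.sum_comm]
    · intro X Y f
      obtain ⟨s, φ, rfl⟩ := hCG.span _ _ f
      simp only [StarCatNu.star_sum, _root_.star_sum, map_sum, hΦ, hCG.ins_star, L_star]
  obtain ⟨F, hF⟩ := key
  refine ⟨F, ?_, fun g X Y f => by rw [hF, hΦ]⟩
  intro X Y X' Y'
  obtain ⟨X, rfl⟩ := hCG.obj_bij.2 X
  obtain ⟨Y, rfl⟩ := hCG.obj_bij.2 Y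
  obtain ⟨X', rfl⟩ := hCG.obj_bij.2 X'
  obtain ⟨Y', rfl⟩ := hCG.obj_bij.2 Y'
  intro g f hne
  rw [hF, hF]
  obtain ⟨s, φ, rfl⟩ := hCG.span _ _ g
  obtain ⟨t, ψ, rfl⟩ := hCG.span _ _ f
  simp only [map_sum, hΦ, Finset.sum_mul_sum]
  refine Finset.sum_eq_zero fun p _ => Finset.sum_eq_zero fun q _ => ?_
  exact L_ne _ _ _ _ _ _ _ _ (fun h => hne (by rw [h]))

theorem aux_norm_ins_le {G : Type} [Group G] {A' : Type} [NonUnitalCStarAlgebra A']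
    {τ : AlgGAction G A'} {R : Type} [NonUnitalRing R] [Module ℂ R] [SMulCommClass ℂ R R]
    [IsScalarTower ℂ R R] [StarRing R] [StarModule ℂ R]
    (wR : IsAlgCrossedProduct G A' τ R)
    {R' : Type} [NonUnitalCStarAlgebra R'] (jR : R →⋆ₙₐ[ℂ] R') (g : G) (a : A') :
    ‖jR (wR.ins g a)‖ ≤ ‖a‖ := by
  let ψ : A' →⋆ₙₐ[ℂ] R' :=
    { toFun := fun a => jR (wR.ins 1 a)
      map_smul' := fun c a => by simp [wR.ins_smul]
      map_zero' := by
        have := wR.ins_smul 1 0 0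
        simp only [zero_smul] at this
        rw [this, map_zero]
      map_add' := fun a b => by rw [wR.ins_add, map_add]
      map_mul' := fun a b => by
        rw [← map_mul, wR.ins_mul, inv_one, τ.one_act, one_mul]
      map_star' := fun a => by
        rw [← map_star, wR.ins_star, inv_one, τ.one_act] }
  have h1 : star (jR (wR.ins g a)) * jR (wR.ins g a) = ψ (star a * a) := by
    show _ = jR (wR.ins 1 _)
    rw [← map_star, ← map_mul, wR.ins_star, wR.ins_mul, τ.mul_act]
    simp [τ.one_act]
  have h2 : ‖jR (wR.ins g a)‖ * ‖jR (wR.ins g a)‖ ≤ ‖a‖ * ‖a‖ := by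
    rw [← CStarRing.norm_star_mul_self, h1, ← CStarRing.norm_star_mul_self (x := a)]
    exact NonUnitalStarAlgHom.norm_apply_le ψ _
  exact abs_le_of_sq_le_sq' (by nlinarith) (norm_nonneg _) |>.2

/-- Let `C` be a possibly non-unital small C*-category with an action of
a group `G`.  Then the canonical homomorphism `ν_C : A(C) ⋊ G → A(C ⋊ G)` of C*-algebras,
determined on generators by `([f], g) ↦ [(f, g)]` for morphisms `f` of `C` and `g ∈ G`,
is an isomorphism; that is, the functor `A` commutes with the formation of maximal
crossed products. -/
theorem A_commutes_with_crossed_products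
    (G : Type) [Group G] (C : StarCatNu) (hC : IsCStar C) (α : GAction G C)
    -- a realization `A₀` of `A^alg(C)` and its completion `A'` (so `A' = A(C)`)
    (A₀ : Type) [NonUnitalRing A₀] [Module ℂ A₀] [SMulCommClass ℂ A₀ A₀]
    [IsScalarTower ℂ A₀ A₀] [StarRing A₀] [StarModule ℂ A₀] (w : IsAAlg C A₀)
    (A' : Type) [NonUnitalCStarAlgebra A'] (j : A₀ →⋆ₙₐ[ℂ] A')
    (hj : IsAlgCompletion A₀ A' j)
    -- the induced `G`-action on `A(C)`
    (τ : AlgGAction G A')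
    (hτ : ∀ (g : G) (X Y : C.Obj) (f : C.Hom X Y),
      τ.act g (j (w.ι f)) = j (w.ι (α.actMap g f)))
    -- a realization `R` of `A(C) ⋊^alg G` and its completion `R'` (so `R' = A(C) ⋊ G`)
    (R : Type) [NonUnitalRing R] [Module ℂ R] [SMulCommClass ℂ R R]
    [IsScalarTower ℂ R R] [StarRing R] [StarModule ℂ R]
    (wR : IsAlgCrossedProduct G A' τ R)
    (R' : Type) [NonUnitalCStarAlgebra R'] (jR : R →⋆ₙₐ[ℂ] R')
    (hjR : IsAlgCompletion R R' jR)
    -- a realization `CG` of `C ⋊^alg G` and its completion `CGc` (so `CGc = C ⋊ G`)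
    (CG : StarCatNu) (hCG : IsCrossedProductAlg G C α CG)
    (CGc : StarCatNu) (κ : StarFunctor CG CGc) (hκ : IsCompletion CG CGc κ)
    -- a realization `S₀` of `A^alg(C ⋊ G)` and its completion `S'` (so `S' = A(C ⋊ G)`)
    (S₀ : Type) [NonUnitalRing S₀] [Module ℂ S₀] [SMulCommClass ℂ S₀ S₀]
    [IsScalarTower ℂ S₀ S₀] [StarRing S₀] [StarModule ℂ S₀] (wS : IsAAlg CGc S₀)
    (S' : Type) [NonUnitalCStarAlgebra S'] (jS : S₀ →⋆ₙₐ[ℂ] S')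
    (hjS : IsAlgCompletion S₀ S' jS)
    -- the canonical homomorphism `ν_C`
    (ν : R' →⋆ₙₐ[ℂ] S')
    (hν : ∀ (g : G) (X Y : C.Obj) (f : C.Hom X (α.actObj g⁻¹ Y)),
      ν (jR (wR.ins g (j (w.ι f)))) = jS (wS.ι (κ.map (hCG.ins g f)))) :
    Function.Bijective ν := by
  classical
  have tact_ne : ∀ (g : G) (Y Y' : C.Obj), Y ≠ Y' → α.actObj g Y ≠ α.actObj g Y' := by
    intro g Y Y' h h'
    apply h
    have := congrArg (α.actObj g⁻¹) h'
    simpa only [α.mul_obj, inv_mul_cancel, α.one_obj] using this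
  let L : ∀ (g : G) (X Y : C.Obj), C.Hom X (α.actObj g⁻¹ Y) →ₗ[ℂ] R' := fun g X Y =>
    { toFun := fun f => jR (wR.ins g (j (w.ι f)))
      map_add' := fun f f' => by rw [w.ι_add, map_add, wR.ins_add, map_add]
      map_smul' := fun c f => by
        rw [w.ι_smul, map_smul, wR.ins_smul, map_smul, RingHom.id_apply] }
  have hL : ∀ g X Y f, L g X Y f = jR (wR.ins g (j (w.ι f))) := fun _ _ _ _ => rfl
  obtain ⟨F, hFo, hF⟩ := hCG.exists_rep L
    (by
      intro g g' X Y Z f f'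
      rw [hL, hL, hL, ← map_mul, wR.ins_mul, hτ, ← map_mul, w.ι_mul_comp, w.ι_castHom])
    (by
      intro g g' X Y Y' Z f f' hne
      rw [hL, hL, ← map_mul, wR.ins_mul, hτ, ← map_mul,
        w.ι_mul_ne _ _ _ _ _ _ (tact_ne _ _ _ hne), map_zero]
      have := wR.ins_smul (g' * g) 0 0
      simp only [zero_smul] at this
      rw [this, map_zero])
    (by
      intro g X Y f
      rw [hL, hL, ← map_star, wR.ins_star, ← map_star, w.ι_star, hτ, w.ι_castHom])
  obtain ⟨F', hFo', hF'⟩ := hκ.exists_extend F hFo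
  obtain ⟨Φ, hΦ⟩ := wS.exists_hom F' hFo'
  let gens : Set R' := {x | ∃ (g : G) (X Y : C.Obj) (f : C.Hom X (α.actObj g⁻¹ Y)),
    x = jR (wR.ins g (j (w.ι f)))}
  let M : Submodule ℂ R' := Submodule.span ℂ gens
  have hMdense : M.topologicalClosure = ⊤ := by
    rw [eq_top_iff]
    have h1 : ∀ g a₀, jR (wR.ins g (j a₀)) ∈ M := by
      intro g a₀
      let l : A₀ →ₗ[ℂ] R' :=
        { toFun := fun a => jR (wR.ins g (j a))
          map_add' := fun f f' => by rw [map_add, wR.ins_add, map_add]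
          map_smul' := fun c f => by
            rw [map_smul, wR.ins_smul, map_smul, RingHom.id_apply] }
      show l a₀ ∈ M
      obtain ⟨s, φ, rfl⟩ := w.span a₀
      rw [map_sum]
      refine M.sum_mem fun p _ => Submodule.subset_span ?_
      obtain ⟨X, Z⟩ := p
      have hZ : Z = α.actObj g⁻¹ (α.actObj g Z) := by
        rw [α.mul_obj, inv_mul_cancel, α.one_obj]
      refine ⟨g, X, α.actObj g Z, C.castHom rfl hZ (φ (X, Z)), ?_⟩
      rw [w.ι_castHom]
      rfl
    have h2 : ∀ g a, jR (wR.ins g a) ∈ M.topologicalClosure := by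
      intro g a
      let l : A' →ₗ[ℂ] R' :=
        { toFun := fun a => jR (wR.ins g a)
          map_add' := fun f f' => by rw [wR.ins_add, map_add]
          map_smul' := fun c f => by
            rw [wR.ins_smul, map_smul, RingHom.id_apply] }
      have hl : Continuous l := (l.mkContinuous 1 (fun a => by
        rw [one_mul]; exact aux_norm_ins_le wR jR g a)).continuous
      show l a ∈ M.topologicalClosure
      refine hj.dense.induction_on (p := fun a => l a ∈ M.topologicalClosure) a
        (M.isClosed_topologicalClosure.preimage hl) (fun a₀ => M.le_topologicalClosure (h1 g a₀))
    intro x _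
    refine hjR.dense.induction_on (p := fun x => x ∈ M.topologicalClosure) x
      M.isClosed_topologicalClosure fun r => ?_
    obtain ⟨s, φ, rfl⟩ := wR.span r
    rw [map_sum]
    exact Submodule.sum_mem _ fun g _ => h2 _ _
  have hMnorm : ∀ x ∈ M, ‖x‖ ≤ ‖ν x‖ := by
    intro x hx
    have hs : ∃ s : S₀, jS s = ν x ∧ Φ s = x := by
      induction hx using Submodule.span_induction with
      | mem x hx =>
        obtain ⟨g, X, Y, f, rfl⟩ := hx
        exact ⟨wS.ι (κ.map (hCG.ins g f)), (hν g X Y f).symm, by rw [hΦ, hF', hF, hL]⟩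
      | zero => exact ⟨0, by simp, by simp⟩
      | add x y _ _ h1 h2 =>
        obtain ⟨s, hs, hs'⟩ := h1
        obtain ⟨t, ht, ht'⟩ := h2
        exact ⟨s + t, by rw [map_add, map_add, hs, ht], by rw [map_add, hs', ht']⟩
      | smul c x _ h1 =>
        obtain ⟨s, hs, hs'⟩ := h1
        exact ⟨c • s, by rw [map_smul, map_smul, hs], by rw [map_smul, hs']⟩
    obtain ⟨s, hs, hs'⟩ := hs
    have h1 : (‖Φ s‖₊ : ℝ≥0∞) ≤ algMaxNorm S₀ s := le_sSup ⟨R', inferInstance, Φ, rfl⟩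
    rw [← hjS.isometric, hs, hs'] at h1
    exact_mod_cast h1
  have hνc : Continuous ν := by
    exact AddMonoidHomClass.continuous_of_bound ν 1 fun x => by
      rw [one_mul]; exact NonUnitalStarAlgHom.norm_apply_le ν x
  have hnorm : ∀ x, ‖x‖ ≤ ‖ν x‖ := by
    intro x
    have hx : x ∈ closure (M : Set R') := by
      rw [← Submodule.topologicalClosure_coe, hMdense]; trivial
    exact closure_minimal (t := {x | ‖x‖ ≤ ‖ν x‖}) hMnorm
      (isClosed_le continuous_norm hνc.norm) hx
  have hanti : AntilipschitzWith 1 ν := AddMonoidHomClass.antilipschitz_of_bound ν fun x => by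
    simpa using hnorm x
  refine ⟨hanti.injective, ?_⟩
  have huc : UniformContinuous ν := by
    exact AddMonoidHomClass.uniformContinuous_of_bound ν 1 fun x => by
      rw [one_mul]; exact NonUnitalStarAlgHom.norm_apply_le ν x
  let N : Submodule ℂ S' :=
    { carrier := Set.range ν
      add_mem' := by
        rintro _ _ ⟨a, rfl⟩ ⟨b, rfl⟩
        exact ⟨a + b, map_add _ _ _⟩
      zero_mem' := ⟨0, map_zero _⟩
      smul_mem' := by
        rintro c _ ⟨a, rfl⟩
        exact ⟨c • a, map_smul _ _ _⟩ }
  have hN : IsClosed (N : Set S') := hanti.isClosed_range huc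
  have hle : ∀ (X Y : CGc.Obj) (h : CGc.Hom X Y), ‖jS (wS.ι h)‖ₑ ≤ CGc.maxNorm h := by
    intro X Y h
    let P : CatRep CGc S' :=
      { map := fun X Y f => jS (wS.ι f)
        map_add := fun X Y f f' => by rw [wS.ι_add, map_add]
        map_smul := fun X Y c f => by rw [wS.ι_smul, map_smul]
        map_comp := fun X Y Z g f => by rw [← map_mul, wS.ι_mul_comp]
        map_star := fun X Y f => by rw [← map_star, wS.ι_star] }
    exact P.enorm_le h
  have hsub : ∀ (X Y : CGc.Obj) (h h' : CGc.Hom X Y), wS.ι (h - h') = wS.ι h - wS.ι h' :=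
    fun X Y h h' => (AddMonoidHom.mk' (fun f : CGc.Hom X Y => wS.ι f) (wS.ι_add X Y)).map_sub h h'
  have hgen : ∀ (X Y : C.Obj) (u : CG.Hom (hCG.obj X) (hCG.obj Y)),
      jS (wS.ι (κ.map u)) ∈ N := by
    intro X Y u
    obtain ⟨s, φ, rfl⟩ := hCG.span X Y u
    let l : CG.Hom (hCG.obj X) (hCG.obj Y) →+ S' :=
      AddMonoidHom.mk' (fun u => jS (wS.ι (κ.map u)))
        (fun a b => by rw [κ.map_add, wS.ι_add, map_add])
    show l _ ∈ N
    rw [map_sum]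
    exact N.sum_mem fun g _ => ⟨_, hν g X Y (φ g)⟩
  have hgen2 : ∀ (X Y : CGc.Obj) (h : CGc.Hom X Y), jS (wS.ι h) ∈ N := by
    intro X Y
    obtain ⟨X, rfl⟩ := hκ.obj_bij.2 X
    obtain ⟨Y, rfl⟩ := hκ.obj_bij.2 Y
    obtain ⟨X, rfl⟩ := hCG.obj_bij.2 X
    obtain ⟨Y, rfl⟩ := hCG.obj_bij.2 Y
    intro h
    rw [← SetLike.mem_coe, ← hN.closure_eq, EMetric.mem_closure_iff]
    intro ε hε
    obtain ⟨u, hu⟩ := hκ.dense _ _ h ε hε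
    refine ⟨_, hgen X Y u, ?_⟩
    rw [edist_eq_enorm_sub, ← map_sub, ← hsub]
    exact (hle _ _ _).trans_lt hu
  intro y
  show y ∈ N
  refine hjS.dense.induction_on (p := fun x => x ∈ N) y hN fun s => ?_
  obtain ⟨t, φ, rfl⟩ := wS.span s
  rw [map_sum]
  exact N.sum_mem fun p _ => hgen2 _ _ _
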